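/- arXiv:2102.06553 — 5 statements merged into one kernel-verified Lean document; each statement's English description precedes it below -/
import Mathlib

section
/- Consider the deterministic LTI system x_{i+1} = A x_i + B u_i, y_i = C x_i + D u_i with state dimension n_x, and assume the pair (A,B) is controllable. Let (ũ_i, ỹ_i)_{i=0}^T be an input/output trajectory generated by this system, and suppose the input sequence ũ is persistently exciting of order L + n_x. Then the column span of the stacked Hankel matrix [H_L(ũ); H_L(ỹ)] equals B_L(A,B,C,D), the set of all L-step input/output trajectories of the system. -/
open Matrix

/-- Hankel matrix of depth `L` with `nc` columns built from the signal `s`: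
its `j`-th column is `(s_j; s_{j+1}; …; s_{j+L-1})`. -/
def Hankel {ns : ℕ} (s : ℕ → Fin ns → ℝ) (L nc : ℕ) :
    Matrix (Fin L × Fin ns) (Fin nc) ℝ :=
  Matrix.of fun p j => s ((j : ℕ) + (p.1 : ℕ)) p.2

/-- Controllability matrix `[B, AB, …, A^{n_x−1}B]` of the pair `(A,B)`. -/
def ctrbMat {nx nu : ℕ} (A : Matrix (Fin nx) (Fin nx) ℝ)
    (B : Matrix (Fin nx) (Fin nu) ℝ) : Matrix (Fin nx) (Fin nx × Fin nu) ℝ :=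
  Matrix.of fun i p => (A ^ (p.1 : ℕ) * B) i p.2

/-- The set `B_L(A,B,C,D)` of `L`-step input/output trajectories of the
deterministic LTI system `x⁺ = Ax + Bu`, `y = Cx + Du`. -/
def BehaviorIO {nx nu ny : ℕ} (A : Matrix (Fin nx) (Fin nx) ℝ)
    (B : Matrix (Fin nx) (Fin nu) ℝ) (C : Matrix (Fin ny) (Fin nx) ℝ)
    (D : Matrix (Fin ny) (Fin nu) ℝ) (L : ℕ) :
    Set ((Fin L × Fin nu → ℝ) × (Fin L × Fin ny → ℝ)) :=
  { v | ∃ x : ℕ → Fin nx → ℝ,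
      (∀ i : Fin L, x (i.val + 1)
          = A.mulVec (x i.val) + B.mulVec (fun k => v.1 (i, k))) ∧
      (∀ i : Fin L, (fun k => v.2 (i, k))
          = C.mulVec (x i.val) + D.mulVec (fun k => v.1 (i, k))) }

/-- A matrix whose rank equals its number of rows has trivial left kernel. -/
theorem eq_zero_of_vecMul_eq_zero_of_rank {m n : Type*} [Fintype m] [Fintype n]
    {M : Matrix m n ℝ} (hM : M.rank = Fintype.card m) {w : m → ℝ} (hw : w ᵥ* M = 0) :
    w = 0 := by
  have hli : LinearIndependent ℝ M.row := by
    rw [linearIndependent_iff_card_eq_finrank_span, Set.finrank, ← M.rank_eq_finrank_span_row, hM]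
  exact Matrix.vecMul_injective_iff.mpr hli (by simpa using hw)

/-- A matrix with trivial left kernel acts surjectively on column vectors. -/
theorem mulVec_surjective_of_vecMul_eq_zero {m n : Type*} [Fintype m] [Fintype n]
    {M : Matrix m n ℝ} (hM : ∀ w, w ᵥ* M = 0 → w = 0) : Function.Surjective M.mulVec := by
  have hli : LinearIndependent ℝ M.row := by
    rw [← Matrix.vecMul_injective_iff]
    exact (injective_iff_map_eq_zero M.vecMulLinear).mpr hM
  have htop : LinearMap.range M.mulVecLin = ⊤ :=
    Submodule.eq_top_of_finrank_eq (by simpa [Matrix.rank] using hli.rank_matrix)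
  exact LinearMap.range_eq_top.mp htop

/-- The left kernel of a Hankel matrix of full row rank, in terms of sequences. -/
theorem eq_zero_of_hankel_annihilator {ns N nc : ℕ} {s : ℕ → Fin ns → ℝ}
    (hs : (Hankel s N nc).rank = N * ns) {w : ℕ → Fin ns → ℝ}
    (hw : ∀ j < nc, ∑ m ∈ Finset.range N, w m ⬝ᵥ s (j + m) = 0) :
    ∀ m < N, w m = 0 := by
  have h0 : (fun p : Fin N × Fin ns => w p.1 p.2) = 0 := by
    refine eq_zero_of_vecMul_eq_zero_of_rank (M := Hankel s N nc) (by simpa using hs) ?_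
    ext j
    have := hw j j.2
    rw [Finset.sum_range] at this
    simpa [Hankel, Matrix.vecMul, dotProduct, Fintype.sum_prod_type] using this
  intro m hm
  ext c
  exact congrFun h0 (⟨m, hm⟩, c)

/-- The weights of `u` obtained by shifting the functional `ξ · x + ∑ η · u` forward in time and
eliminating the later states, listed in order of decreasing time. -/
def shiftedWeights {nx nu : ℕ} (A : Matrix (Fin nx) (Fin nx) ℝ)
    (B : Matrix (Fin nx) (Fin nu) ℝ) (L : ℕ) (ξ : Fin nx → ℝ) (η : ℕ → Fin nu → ℝ) (i : ℕ) :
    Fin nu → ℝ :=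
  if i < nx then 0
  else if i < L + nx then η (L + nx - 1 - i)
  else ξ ᵥ* (A ^ (i - (L + nx)) * B)

/-- A relation between states and inputs propagates along the trajectory. -/
theorem shiftedWeights_relation {nx nu : ℕ} {A : Matrix (Fin nx) (Fin nx) ℝ}
    {B : Matrix (Fin nx) (Fin nu) ℝ} {L : ℕ} {u : ℕ → Fin nu → ℝ} {x : ℕ → Fin nx → ℝ}
    (hx : ∀ i, x (i + 1) = A *ᵥ x i + B *ᵥ u i) (ξ : Fin nx → ℝ) (η : ℕ → Fin nu → ℝ)
    (s : ℕ) (hs : s ≤ nx) (j : ℕ) :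
    (ξ ᵥ* A ^ s) ⬝ᵥ x j +
        ∑ m ∈ Finset.range (L + nx),
          shiftedWeights A B L ξ η (L + nx - 1 - m + s) ⬝ᵥ u (j + m) =
      ξ ⬝ᵥ x (j + s) + ∑ k ∈ Finset.range L, η k ⬝ᵥ u (j + s + k) := by
  induction s generalizing j with
  | zero =>
    rw [Finset.sum_range_add]
    have h1 : ∑ m ∈ Finset.range nx,
        shiftedWeights A B L ξ η (L + nx - 1 - (L + m) + 0) ⬝ᵥ u (j + (L + m)) = 0 := by
      refine Finset.sum_eq_zero fun m hm => ?_
      rw [Finset.mem_range] at hm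
      rw [shiftedWeights, if_pos (by omega), zero_dotProduct]
    have h2 : ∀ m ∈ Finset.range L,
        shiftedWeights A B L ξ η (L + nx - 1 - m + 0) ⬝ᵥ u (j + m) = η m ⬝ᵥ u (j + 0 + m) := by
      intro m hm
      rw [Finset.mem_range] at hm
      rw [shiftedWeights, if_neg (by omega), if_pos (by omega)]
      congr 2
      omega
    rw [h1, Finset.sum_congr rfl h2]
    simp
  | succ s ih =>
    have ih' := ih (by omega) (j + 1)
    rw [show j + (s + 1) = j + 1 + s by omega, ← ih']
    obtain ⟨M, hM⟩ : ∃ M, L + nx = M + 1 := ⟨L + nx - 1, by omega⟩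
    rw [hM, Finset.sum_range_succ', Finset.sum_range_succ]
    have h1 : shiftedWeights A B L ξ η (M + 1 - 1 - M + s) = 0 := by
      rw [shiftedWeights, if_pos (by omega)]
    have h2 : shiftedWeights A B L ξ η (M + 1 - 1 - 0 + (s + 1)) = ξ ᵥ* (A ^ s * B) := by
      rw [shiftedWeights, if_neg (by omega), if_neg (by omega)]
      congr 3
      omega
    have h3 : ∀ m ∈ Finset.range M,
        shiftedWeights A B L ξ η (M + 1 - 1 - (m + 1) + (s + 1)) ⬝ᵥ u (j + (m + 1)) =
          shiftedWeights A B L ξ η (M + 1 - 1 - m + s) ⬝ᵥ u (j + 1 + m) := by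
      intro m hm
      rw [Finset.mem_range] at hm
      congr 2 <;> omega
    rw [h1, h2, Finset.sum_congr rfl h3, hx j, zero_dotProduct, dotProduct_add,
      dotProduct_mulVec, dotProduct_mulVec, vecMul_vecMul, vecMul_vecMul, pow_succ]
    simp only [add_zero]
    ring

/-- For a controllable pair and a persistently exciting input, no nontrivial linear relation
holds between the state and the next `L` inputs along the trajectory. -/
theorem state_input_relation_trivial {nx nu L T : ℕ} {A : Matrix (Fin nx) (Fin nx) ℝ}
    {B : Matrix (Fin nx) (Fin nu) ℝ} (hctrb : (ctrbMat A B).rank = nx)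
    {u : ℕ → Fin nu → ℝ} {x : ℕ → Fin nx → ℝ} (hLT : L + nx ≤ T + 1)
    (hx : ∀ i, x (i + 1) = A *ᵥ x i + B *ᵥ u i)
    (hpe : (Hankel u (L + nx) (T + 2 - (L + nx))).rank = (L + nx) * nu)
    {ξ : Fin nx → ℝ} {η : ℕ → Fin nu → ℝ}
    (hrel : ∀ j < T + 2 - L, ξ ⬝ᵥ x j + ∑ k ∈ Finset.range L, η k ⬝ᵥ u (j + k) = 0) :
    ξ = 0 ∧ ∀ k < L, η k = 0 := by
  set Z := shiftedWeights A B L ξ η with hZ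
  set a : ℕ → ℝ := A.charpoly.coeff
  have hdeg : A.charpoly.natDegree = nx := by simp [Matrix.charpoly_natDegree_eq_dim]
  have hlead : a nx = 1 := by
    have := A.charpoly_monic.coeff_natDegree
    rwa [hdeg] at this
  have hCH : ∑ s ∈ Finset.range (nx + 1), a s • A ^ s = 0 := by
    have := A.aeval_self_charpoly
    rwa [Polynomial.aeval_eq_sum_range, hdeg] at this
  have hw := eq_zero_of_hankel_annihilator hpe
    (w := fun m => ∑ s ∈ Finset.range (nx + 1), a s • Z (L + nx - 1 - m + s)) (by
      intro j hj
      have hsum : ∑ s ∈ Finset.range (nx + 1), a s * ((ξ ᵥ* A ^ s) ⬝ᵥ x j +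
          ∑ m ∈ Finset.range (L + nx), Z (L + nx - 1 - m + s) ⬝ᵥ u (j + m)) = 0 := by
        refine Finset.sum_eq_zero fun s hs => ?_
        rw [Finset.mem_range] at hs
        rw [shiftedWeights_relation hx ξ η s (by omega) j, hrel (j + s) (by omega), mul_zero]
      have hstate : ∑ s ∈ Finset.range (nx + 1), a s * ((ξ ᵥ* A ^ s) ⬝ᵥ x j) = 0 := by
        have := congrArg (fun M => (ξ ᵥ* M) ⬝ᵥ x j) hCH
        simpa [Matrix.vecMul_sum, sum_dotProduct, Matrix.vecMul_smul] using this
      simp only [mul_add, Finset.sum_add_distrib, hstate, zero_add, Finset.mul_sum] at hsum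
      rw [Finset.sum_comm] at hsum
      simpa [sum_dotProduct] using hsum)
  have hZ0 : ∀ i < L + nx + nx, Z i = 0 := by
    intro i
    induction i using Nat.strong_induction_on with
    | _ i ih =>
      intro hi
      rcases lt_or_ge i nx with hlt | hge
      · rw [hZ, shiftedWeights, if_pos hlt]
      · have h := hw (L + nx - 1 - (i - nx)) (by omega)
        rw [Finset.sum_range_succ, hlead, one_smul, Finset.sum_eq_zero, zero_add] at h
        · rwa [show L + nx - 1 - (L + nx - 1 - (i - nx)) + nx = i by omega] at h
        · intro s hs
          rw [Finset.mem_range] at hs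
          rw [ih _ (by omega) (by omega), smul_zero]
  constructor
  · refine eq_zero_of_vecMul_eq_zero_of_rank (M := ctrbMat A B) (by simpa using hctrb) ?_
    ext ⟨i, c⟩
    have h := hZ0 (L + nx + i) (by omega)
    rw [hZ, shiftedWeights, if_neg (by omega), if_neg (by omega), Nat.add_sub_cancel_left] at h
    exact congrFun h c
  · intro k hk
    have h := hZ0 (L + nx - 1 - k) (by omega)
    rw [hZ, shiftedWeights, if_neg (by omega), if_pos (by omega)] at h
    rwa [show L + nx - 1 - (L + nx - 1 - k) = k by omega] at h

/-- Any initial state and any input string of length `L` is a combination of data windows. -/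
theorem exists_combination_of_windows {nx nu L T : ℕ} {A : Matrix (Fin nx) (Fin nx) ℝ}
    {B : Matrix (Fin nx) (Fin nu) ℝ} (hctrb : (ctrbMat A B).rank = nx)
    {u : ℕ → Fin nu → ℝ} {x : ℕ → Fin nx → ℝ} (hLT : L + nx ≤ T + 1)
    (hx : ∀ i, x (i + 1) = A *ᵥ x i + B *ᵥ u i)
    (hpe : (Hankel u (L + nx) (T + 2 - (L + nx))).rank = (L + nx) * nu)
    (x₀ : Fin nx → ℝ) (v : Fin L × Fin nu → ℝ) :
    ∃ g : Fin (T + 2 - L) → ℝ, ∑ j, g j • x j = x₀ ∧ Hankel u L (T + 2 - L) *ᵥ g = v := by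
  let X : Matrix (Fin nx) (Fin (T + 2 - L)) ℝ := Matrix.of fun i j => x j i
  have hsurj := mulVec_surjective_of_vecMul_eq_zero
    (M := Matrix.fromRows X (Hankel u L (T + 2 - L))) (by
      intro w hw
      have hrel := state_input_relation_trivial hctrb hLT hx hpe (ξ := w ∘ Sum.inl)
        (η := fun k c => if hk : k < L then w (Sum.inr (⟨k, hk⟩, c)) else 0) (by
          intro j hj
          have h := congrFun hw ⟨j, hj⟩
          rw [Finset.sum_range]
          simpa [X, Hankel, Matrix.vecMul, dotProduct, Fintype.sum_prod_type] using h)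
      ext (i | ⟨k, c⟩)
      · exact congrFun hrel.1 i
      · simpa using congrFun (hrel.2 k k.2) c)
  obtain ⟨g, hg⟩ := hsurj (Sum.elim x₀ v)
  rw [Matrix.fromRows_mulVec] at hg
  refine ⟨g, ?_, ?_⟩
  · ext i
    have h := congrFun hg (Sum.inl i)
    simpa [X, Matrix.mulVec, dotProduct, Finset.sum_apply, mul_comm] using h
  · ext p
    exact congrFun hg (Sum.inr p)

/-- A Hankel matrix times a vector, one block of rows at a time. -/
theorem hankel_mulVec_block {ns L nc : ℕ} (s : ℕ → Fin ns → ℝ) (g : Fin nc → ℝ) (k : Fin L) :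
    (fun c => (Hankel s L nc *ᵥ g) (k, c)) = ∑ j, g j • s (j + k) := by
  ext c
  simp [Hankel, Matrix.mulVec, dotProduct, mul_comm]

/-- **Willems' fundamental lemma** (Lemma 1): for a controllable deterministic LTI
system and data with a persistently exciting input of order `L + n_x`, the column
span of the stacked Hankel matrix equals the set of `L`-step trajectories. -/
theorem willems_fundamental_lemma
    (nx nu ny L T : ℕ)
    (A : Matrix (Fin nx) (Fin nx) ℝ) (B : Matrix (Fin nx) (Fin nu) ℝ)
    (C : Matrix (Fin ny) (Fin nx) ℝ) (D : Matrix (Fin ny) (Fin nu) ℝ)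
    (hctrb : (ctrbMat A B).rank = nx)
    (ut : ℕ → Fin nu → ℝ) (yt : ℕ → Fin ny → ℝ) (xt : ℕ → Fin nx → ℝ)
    (hLT : L + nx ≤ T + 1)
    (hstate : ∀ i < T, xt (i + 1) = A.mulVec (xt i) + B.mulVec (ut i))
    (hout : ∀ i ≤ T, yt i = C.mulVec (xt i) + D.mulVec (ut i))
    (hpe : (Hankel ut (L + nx) (T + 2 - (L + nx))).rank = (L + nx) * nu) :
    { v : (Fin L × Fin nu → ℝ) × (Fin L × Fin ny → ℝ) |
        ∃ g : Fin (T + 2 - L) → ℝ,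
          (Hankel ut L (T + 2 - L)).mulVec g = v.1 ∧
          (Hankel yt L (T + 2 - L)).mulVec g = v.2 } = BehaviorIO A B C D L := by
  obtain ⟨x, hx0, hx⟩ : ∃ x : ℕ → Fin nx → ℝ, x 0 = xt 0 ∧
      ∀ i, x (i + 1) = A *ᵥ x i + B *ᵥ ut i :=
    ⟨fun i => Nat.rec (xt 0) (fun i z => A *ᵥ z + B *ᵥ ut i) i, rfl, fun _ => rfl⟩
  have hxt : ∀ i ≤ T, xt i = x i := by
    intro i
    induction i with
    | zero => exact fun _ => hx0.symm
    | succ i ih => intro hi; rw [hstate i (by omega), hx, ih (by omega)]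
  have hstep : ∀ (g : Fin (T + 2 - L) → ℝ) (k : ℕ), ∑ j, g j • x (j + (k + 1)) =
      A *ᵥ ∑ j, g j • x (j + k) + B *ᵥ ∑ j, g j • ut (j + k) := by
    intro g k
    simp [← add_assoc, hx, Matrix.mulVec_sum, Matrix.mulVec_smul, Finset.sum_add_distrib]
  have hy : ∀ (g : Fin (T + 2 - L) → ℝ) (k : Fin L), ∑ j, g j • yt (j + k) =
      C *ᵥ ∑ j, g j • x (j + k) + D *ᵥ ∑ j, g j • ut (j + k) := by
    intro g k
    rw [Matrix.mulVec_sum, Matrix.mulVec_sum, ← Finset.sum_add_distrib]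
    refine Finset.sum_congr rfl fun j _ => ?_
    rw [hout _ (by omega), hxt _ (by omega), smul_add, Matrix.mulVec_smul, Matrix.mulVec_smul]
  ext ⟨v₁, v₂⟩
  constructor
  · rintro ⟨g, rfl, rfl⟩
    refine ⟨fun k => ∑ j, g j • x (j + k), fun k => ?_, fun k => ?_⟩
    · simp only [hankel_mulVec_block]
      exact hstep g k
    · simp only [hankel_mulVec_block]
      exact hy g k
  · rintro ⟨z, hz, hzy⟩
    obtain ⟨g, hg0, hg⟩ := exists_combination_of_windows hctrb hLT hx hpe (z 0) v₁
    have hu : ∀ k : Fin L, (fun c => v₁ (k, c)) = ∑ j, g j • ut (j + k) := by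
      intro k
      rw [← hg, hankel_mulVec_block]
    have hzk : ∀ k ≤ L, ∑ j, g j • x (j + k) = z k := by
      intro k
      induction k with
      | zero => exact fun _ => hg0
      | succ k ih =>
        intro hk
        have h := hz ⟨k, hk⟩
        simp only [hu] at h
        rw [h, hstep, ih (by omega)]
    refine ⟨g, hg, ?_⟩
    ext ⟨k, c⟩
    have h := hzy k
    simp only [hu] at h
    rw [← hzk k k.2.le, ← hy, ← hankel_mulVec_block] at h
    exact (congrFun h c).symm
end

section
/- Consider the dynamics x_{i+1} = A x_i + B u_i + w_i over the horizon i = 0,…,L−1, written in stacked form as x = Z𝒜x + Z𝓑u + δ with δ = (x_0; w_0; …; w_{L−1}). For every block-lower-triangular feedback matrix K (so that u = Kx), there exist block-lower-triangular matrices (Φ_x, Φ_u) satisfying the affine constraint [I − Z𝒜, −Z𝓑][Φ_x; Φ_u] = I such that for every initial state x_0 and every disturbance sequence w_0,…,w_{L−1}, the closed-loop trajectory satisfies (x; u) = [Φ_x; Φ_u](x_0; w_0; …; w_{L−1}). -/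
open Matrix

/-- The block matrix `Z𝒜`: `Z` is the block-downshift operator and
`𝒜 = blkdiag(A,…,A,O)` with `L` copies of `A`, so `Z𝒜` has block `A` in
block-position `(j+1, j)` for `j = 0,…,L−1` and zeros elsewhere. -/
def ZA {nx : ℕ} (L : ℕ) (A : Matrix (Fin nx) (Fin nx) ℝ) :
    Matrix (Fin (L+1) × Fin nx) (Fin (L+1) × Fin nx) ℝ :=
  Matrix.of fun p q => if (p.1 : ℕ) = (q.1 : ℕ) + 1 then A p.2 q.2 else 0

/-- The block matrix `Z𝓑` with `𝓑 = blkdiag(B,…,B,O)` (`L` copies of `B`). -/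
def ZB {nx nu : ℕ} (L : ℕ) (B : Matrix (Fin nx) (Fin nu) ℝ) :
    Matrix (Fin (L+1) × Fin nx) (Fin (L+1) × Fin nu) ℝ :=
  Matrix.of fun p q => if (p.1 : ℕ) = (q.1 : ℕ) + 1 then B p.2 q.2 else 0

/-- A block-partitioned matrix is block-lower-triangular if all blocks strictly
above the block diagonal vanish. -/
def BlockLowerTri {n1 n2 a b : ℕ} (M : Matrix (Fin n1 × Fin a) (Fin n2 × Fin b) ℝ) : Prop :=
  ∀ p q, (p.1 : ℕ) < (q.1 : ℕ) → M p q = 0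

/-- The stacked vector `δ = (x_0; w_0; …; w_{L−1})`. -/
def delta {nx : ℕ} (L : ℕ) (x0 : Fin nx → ℝ) (w : ℕ → Fin nx → ℝ) :
    Fin (L+1) × Fin nx → ℝ :=
  fun p => if (p.1 : ℕ) = 0 then x0 p.2 else w ((p.1 : ℕ) - 1) p.2

/-- If the blocks of `M` vanish above the `k`-th block sub-diagonal and those of `N` above the
`l`-th, then the blocks of `M * N` vanish above the `(k + l)`-th. -/
theorem mul_apply_eq_zero_of_lt_add {n1 n2 n3 a b c k l : ℕ}
    {M : Matrix (Fin n1 × Fin a) (Fin n2 × Fin b) ℝ}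
    {N : Matrix (Fin n2 × Fin b) (Fin n3 × Fin c) ℝ}
    (hM : ∀ p q, (p.1 : ℕ) < (q.1 : ℕ) + k → M p q = 0)
    (hN : ∀ p q, (p.1 : ℕ) < (q.1 : ℕ) + l → N p q = 0)
    (p : Fin n1 × Fin a) (q : Fin n3 × Fin c) (h : (p.1 : ℕ) < (q.1 : ℕ) + (k + l)) :
    (M * N) p q = 0 := by
  rw [Matrix.mul_apply]
  refine Finset.sum_eq_zero fun r _ => ?_
  by_cases hr : (p.1 : ℕ) < (r.1 : ℕ) + k
  · rw [hM p r hr, zero_mul]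
  · rw [hN r q (by omega), mul_zero]

theorem BlockLowerTri.mul {n1 n2 n3 a b c : ℕ}
    {M : Matrix (Fin n1 × Fin a) (Fin n2 × Fin b) ℝ}
    {N : Matrix (Fin n2 × Fin b) (Fin n3 × Fin c) ℝ}
    (hM : BlockLowerTri M) (hN : BlockLowerTri N) : BlockLowerTri (M * N) :=
  mul_apply_eq_zero_of_lt_add (k := 0) (l := 0) hM hN

theorem pow_apply_eq_zero_of_lt_add {n a : ℕ} {N : Matrix (Fin n × Fin a) (Fin n × Fin a) ℝ}
    (hN : ∀ p q, (p.1 : ℕ) < (q.1 : ℕ) + 1 → N p q = 0) (k : ℕ) :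
    ∀ p q, (p.1 : ℕ) < (q.1 : ℕ) + k → (N ^ k) p q = 0 := by
  induction k with
  | zero =>
    intro p q h
    rw [pow_zero, Matrix.one_apply_ne]
    rintro rfl
    exact lt_irrefl _ h
  | succ k ih =>
    rw [pow_succ]
    exact mul_apply_eq_zero_of_lt_add ih hN

/-- If `N` is strictly block-lower-triangular, then `1 - N` has a block-lower-triangular
two-sided inverse. -/
theorem exists_blockLowerTri_inverse_one_sub {n a : ℕ}
    {N : Matrix (Fin n × Fin a) (Fin n × Fin a) ℝ}
    (hN : ∀ p q, (p.1 : ℕ) < (q.1 : ℕ) + 1 → N p q = 0) :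
    ∃ P : Matrix (Fin n × Fin a) (Fin n × Fin a) ℝ,
      BlockLowerTri P ∧ (1 - N) * P = 1 ∧ P * (1 - N) = 1 := by
  have hpow : N ^ n = 0 := by
    ext p q
    exact pow_apply_eq_zero_of_lt_add hN n p q (by omega)
  refine ⟨∑ k ∈ Finset.range n, N ^ k, fun p q h => ?_, ?_, ?_⟩
  · rw [Matrix.sum_apply]
    exact Finset.sum_eq_zero fun k _ => pow_apply_eq_zero_of_lt_add hN k p q (by omega)
  · rw [mul_neg_geom_sum, hpow, sub_zero]
  · rw [geom_sum_mul_neg, hpow, sub_zero]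

theorem ZA_eq_ZB {nx : ℕ} (L : ℕ) (A : Matrix (Fin nx) (Fin nx) ℝ) : ZA L A = ZB L A := rfl

theorem ZB_apply_eq_zero_of_lt {nx nu : ℕ} (L : ℕ) (B : Matrix (Fin nx) (Fin nu) ℝ)
    (p : Fin (L + 1) × Fin nx) (q : Fin (L + 1) × Fin nu) (h : (p.1 : ℕ) < (q.1 : ℕ) + 1) :
    ZB L B p q = 0 :=
  if_neg h.ne

theorem ZB_mulVec_of_eq_zero {nx nu : ℕ} (L : ℕ) (B : Matrix (Fin nx) (Fin nu) ℝ)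
    (v : Fin (L + 1) × Fin nu → ℝ) (p : Fin (L + 1) × Fin nx) (hp : (p.1 : ℕ) = 0) :
    (ZB L B *ᵥ v) p = 0 :=
  Finset.sum_eq_zero fun q _ =>
    mul_eq_zero_of_left (ZB_apply_eq_zero_of_lt L B p q (by omega)) (v q)

theorem ZB_mulVec_of_eq_succ {nx nu : ℕ} (L : ℕ) (B : Matrix (Fin nx) (Fin nu) ℝ)
    (v : ℕ → Fin nu → ℝ) (p : Fin (L + 1) × Fin nx) (i : ℕ) (hp : (p.1 : ℕ) = i + 1) :
    (ZB L B *ᵥ fun q => v q.1 q.2) p = (B *ᵥ v i) p.2 := by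
  simp only [Matrix.mulVec, dotProduct, Fintype.sum_prod_type]
  rw [Finset.sum_eq_single ⟨i, by omega⟩]
  · simp [ZB, hp]
  · intro j _ hj
    have hji : (p.1 : ℕ) ≠ (j : ℕ) + 1 := fun h => hj (Fin.ext (by simp only; omega))
    simp [ZB, hji]
  · simp

/-- The stacked form `x = Z𝒜 x + Z𝓑 u + δ` of the dynamics. -/
theorem stacked_dynamics {nx nu : ℕ} (L : ℕ)
    (A : Matrix (Fin nx) (Fin nx) ℝ) (B : Matrix (Fin nx) (Fin nu) ℝ)
    (w x : ℕ → Fin nx → ℝ) (u : ℕ → Fin nu → ℝ)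
    (hx : ∀ i < L, x (i + 1) = A *ᵥ x i + B *ᵥ u i + w i) :
    (fun p : Fin (L + 1) × Fin nx => x p.1 p.2) =
      (ZA L A *ᵥ fun q => x q.1 q.2) + (ZB L B *ᵥ fun q => u q.1 q.2) + delta L (x 0) w := by
  funext p
  simp only [Pi.add_apply, ZA_eq_ZB]
  rcases hp : (p.1 : ℕ) with _ | i
  · simp [ZB_mulVec_of_eq_zero L _ _ p hp, delta, hp]
  · rw [ZB_mulVec_of_eq_succ L A x p i hp, ZB_mulVec_of_eq_succ L B u p i hp, hx i (by omega)]
    simp [delta, hp]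

/-- **SLS, achievability direction** (Theorem 1, part 1): every block-lower-triangular
state feedback `u = Kx` for `x⁺ = Ax + Bu + w` is achieved by some block-lower-triangular
system response `(Φx, Φu)` lying on the affine subspace `[I − Z𝒜, −Z𝓑][Φx; Φu] = I`,
i.e. the closed-loop trajectories satisfy `(x; u) = [Φx; Φu](x_0; w)`. -/
theorem sls_parametrizes_responses
    (nx nu L : ℕ)
    (A : Matrix (Fin nx) (Fin nx) ℝ) (B : Matrix (Fin nx) (Fin nu) ℝ)
    (K : Matrix (Fin (L+1) × Fin nu) (Fin (L+1) × Fin nx) ℝ)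
    (hK : BlockLowerTri K) :
    ∃ (Φx : Matrix (Fin (L+1) × Fin nx) (Fin (L+1) × Fin nx) ℝ)
      (Φu : Matrix (Fin (L+1) × Fin nu) (Fin (L+1) × Fin nx) ℝ),
      BlockLowerTri Φx ∧ BlockLowerTri Φu ∧
      (1 - ZA L A) * Φx - ZB L B * Φu = 1 ∧
      ∀ (x0 : Fin nx → ℝ) (w : ℕ → Fin nx → ℝ)
        (x : ℕ → Fin nx → ℝ) (u : ℕ → Fin nu → ℝ),
        x 0 = x0 →
        (∀ p : Fin (L+1) × Fin nu,
          u (p.1 : ℕ) p.2 = K.mulVec (fun q : Fin (L+1) × Fin nx => x (q.1 : ℕ) q.2) p) →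
        (∀ i < L, x (i + 1) = A.mulVec (x i) + B.mulVec (u i) + w i) →
        (∀ p : Fin (L+1) × Fin nx, x (p.1 : ℕ) p.2 = Φx.mulVec (delta L x0 w) p) ∧
        (∀ p : Fin (L+1) × Fin nu, u (p.1 : ℕ) p.2 = Φu.mulVec (delta L x0 w) p) := by
  have hN : ∀ p q, (p.1 : ℕ) < (q.1 : ℕ) + 1 → (ZA L A + ZB L B * K) p q = 0 := by
    intro p q h
    rw [Matrix.add_apply, ZA_eq_ZB, ZB_apply_eq_zero_of_lt L A p q h, zero_add]
    exact mul_apply_eq_zero_of_lt_add (k := 1) (l := 0) (ZB_apply_eq_zero_of_lt L B) hK p q h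
  obtain ⟨P, hP, hMP, hPM⟩ := exists_blockLowerTri_inverse_one_sub hN
  refine ⟨P, K * P, hP, hK.mul hP, ?_, ?_⟩
  · rw [← Matrix.mul_assoc, ← Matrix.sub_mul, sub_sub, hMP]
  · rintro _ w x u rfl hu hx
    have hU : (fun p : Fin (L + 1) × Fin nu => u p.1 p.2) = K *ᵥ fun q => x q.1 q.2 := funext hu
    have hX : (fun p : Fin (L + 1) × Fin nx => x p.1 p.2) = P *ᵥ delta L (x 0) w := by
      have hδ : (1 - (ZA L A + ZB L B * K)) *ᵥ (fun p : Fin (L + 1) × Fin nx => x p.1 p.2) =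
          delta L (x 0) w := by
        rw [Matrix.sub_mulVec, Matrix.one_mulVec, Matrix.add_mulVec, ← Matrix.mulVec_mulVec, ← hU,
          sub_eq_iff_eq_add']
        exact stacked_dynamics L A B w x u hx
      rw [← hδ, Matrix.mulVec_mulVec, hPM, Matrix.one_mulVec]
    refine ⟨congrFun hX, congrFun ?_⟩
    rw [← Matrix.mulVec_mulVec, ← hX, hU]
end

section
/- Let (ũ_i, w̃_i, x̃_i) satisfy x̃_{i+1} = A x̃_i + B ũ_i + w̃_i, and let (Φ_x, Φ_u) satisfy [I − Z𝒜, −Z𝓑][Φ_x; Φ_u] = I. Suppose G is a matrix with [Φ_x; Φ_u] = [H_{L+1}(x̃); H_L(ũ)] G. Then [H_{L+1,1}(x̃); H_L(w̃)] G = I, and consequently, for every (x_0; w), the vector ĝ = G (x_0; w) satisfies [H_{L+1,1}(x̃); H_L(w̃)] ĝ = (x_0; w) and [H_{L+1}(x̃); H_L(ũ)] ĝ = [Φ_x; Φ_u](x_0; w). -/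
open Matrix

/-- The block matrix `Z𝓑` mapping the `L` stacked input blocks into the `L+1`
stacked state blocks (`𝓑 = blkdiag(B,…,B,O)` with `L` copies of `B`). -/
def ZBr {nx nu : ℕ} (L : ℕ) (B : Matrix (Fin nx) (Fin nu) ℝ) :
    Matrix (Fin (L+1) × Fin nx) (Fin L × Fin nu) ℝ :=
  Matrix.of fun p q => if (p.1 : ℕ) = (q.1 : ℕ) + 1 then B p.2 q.2 else 0

/-- The stacked matrix `[H_{L+1,1}(x̃); H_L(w̃)]`: first block row `[x̃_0, x̃_1, …]`,
followed by the Hankel matrix of the disturbance data. -/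
def firstW {nx : ℕ} (L nc : ℕ) (wt : ℕ → Fin nx → ℝ) (xt : ℕ → Fin nx → ℝ) :
    Matrix (Fin (L+1) × Fin nx) (Fin nc) ℝ :=
  Matrix.of fun p j =>
    if (p.1 : ℕ) = 0 then xt (j : ℕ) p.2 else wt ((j : ℕ) + ((p.1 : ℕ) - 1)) p.2

theorem ZA_mul_zero_apply {nx L : ℕ} {n : Type*} (A : Matrix (Fin nx) (Fin nx) ℝ)
    (M : Matrix (Fin (L+1) × Fin nx) n ℝ) (a : Fin nx) (j : n) :
    (ZA L A * M) (0, a) j = 0 := by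
  simp [Matrix.mul_apply, ZA]

theorem ZA_mul_succ_apply {nx L : ℕ} {n : Type*} (A : Matrix (Fin nx) (Fin nx) ℝ)
    (M : Matrix (Fin (L+1) × Fin nx) n ℝ) (k : Fin L) (a : Fin nx) (j : n) :
    (ZA L A * M) (k.succ, a) j = A.mulVec (fun b => M (k.castSucc, b) j) a := by
  simp only [Matrix.mul_apply, ZA, Matrix.of_apply, Fintype.sum_prod_type, Matrix.mulVec,
    dotProduct]
  rw [Finset.sum_eq_single k.castSucc]
  · simp
  · intro q _ hq
    have hne : (k : ℕ) ≠ q := fun h => hq (Fin.ext h.symm)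
    simp [hne]
  · simp

theorem ZBr_mul_zero_apply {nx nu L : ℕ} {n : Type*} (B : Matrix (Fin nx) (Fin nu) ℝ)
    (M : Matrix (Fin L × Fin nu) n ℝ) (a : Fin nx) (j : n) :
    (ZBr L B * M) (0, a) j = 0 := by
  simp [Matrix.mul_apply, ZBr]

theorem ZBr_mul_succ_apply {nx nu L : ℕ} {n : Type*} (B : Matrix (Fin nx) (Fin nu) ℝ)
    (M : Matrix (Fin L × Fin nu) n ℝ) (k : Fin L) (a : Fin nx) (j : n) :
    (ZBr L B * M) (k.succ, a) j = B.mulVec (fun b => M (k, b) j) a := by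
  simp only [Matrix.mul_apply, ZBr, Matrix.of_apply, Fintype.sum_prod_type, Matrix.mulVec,
    dotProduct]
  rw [Finset.sum_eq_single k]
  · simp
  · intro q _ hq
    have hne : (k : ℕ) ≠ q := fun h => hq (Fin.ext h.symm)
    simp [hne]
  · simp

/-- Applying `[I − Z𝒜, −Z𝓑]` to the state and input Hankel matrices of a trajectory recovers
the initial states and the disturbances. -/
theorem firstW_eq_of_dynamics {nx nu L T : ℕ}
    {A : Matrix (Fin nx) (Fin nx) ℝ} {B : Matrix (Fin nx) (Fin nu) ℝ}
    {ut : ℕ → Fin nu → ℝ} {wt xt : ℕ → Fin nx → ℝ}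
    (hdyn : ∀ i < T, xt (i + 1) = A.mulVec (xt i) + B.mulVec (ut i) + wt i) :
    firstW L (T + 1 - L) wt xt =
      (1 - ZA L A) * Hankel xt (L+1) (T + 1 - L) - ZBr L B * Hankel ut L (T + 1 - L) := by
  ext ⟨p, a⟩ j
  rw [Matrix.sub_mul, Matrix.one_mul, Matrix.sub_apply, Matrix.sub_apply]
  refine Fin.cases ?_ (fun k => ?_) p
  · rw [ZA_mul_zero_apply, ZBr_mul_zero_apply]
    simp [firstW, Hankel]
  · rw [ZA_mul_succ_apply, ZBr_mul_succ_apply]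
    have hx := congrFun (hdyn (j + k) (by omega)) a
    simp only [Pi.add_apply] at hx
    simp only [firstW, Hankel, Matrix.of_apply, Fin.val_succ, Fin.val_castSucc,
      Nat.add_sub_cancel, Nat.succ_ne_zero, if_false, ← add_assoc, hx]
    ring

/-- Key step of Lemma 2: if `[Φx; Φu] = [H_{L+1}(x̃); H_L(ũ)] G` with `(Φx, Φu)` on the
SLS subspace `[I − Z𝒜, −Z𝓑][Φx; Φu] = I`, then `[H_{L+1,1}(x̃); H_L(w̃)] G = I`, so with
`ĝ = G(x_0; w)` one has `[H_{L+1,1}(x̃); H_L(w̃)] ĝ = (x_0; w)` and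
`[H_{L+1}(x̃); H_L(ũ)] ĝ = [Φx; Φu](x_0; w)`. -/
theorem hankel_realizes_sls_response
    (nx nu L T : ℕ)
    (A : Matrix (Fin nx) (Fin nx) ℝ) (B : Matrix (Fin nx) (Fin nu) ℝ)
    (ut : ℕ → Fin nu → ℝ) (wt : ℕ → Fin nx → ℝ) (xt : ℕ → Fin nx → ℝ)
    (hdyn : ∀ i < T, xt (i + 1) = A.mulVec (xt i) + B.mulVec (ut i) + wt i)
    (Φx : Matrix (Fin (L+1) × Fin nx) (Fin (L+1) × Fin nx) ℝ)
    (Φu : Matrix (Fin L × Fin nu) (Fin (L+1) × Fin nx) ℝ)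
    (hconstr : (1 - ZA L A) * Φx - ZBr L B * Φu = 1)
    (G : Matrix (Fin (T + 1 - L)) (Fin (L+1) × Fin nx) ℝ)
    (hGx : Φx = Hankel xt (L+1) (T + 1 - L) * G)
    (hGu : Φu = Hankel ut L (T + 1 - L) * G) :
    firstW L (T + 1 - L) wt xt * G = 1 ∧
    ∀ δ : Fin (L+1) × Fin nx → ℝ,
      (firstW L (T + 1 - L) wt xt).mulVec (G.mulVec δ) = δ ∧
      (Hankel xt (L+1) (T + 1 - L)).mulVec (G.mulVec δ) = Φx.mulVec δ ∧
      (Hankel ut L (T + 1 - L)).mulVec (G.mulVec δ) = Φu.mulVec δ := by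
  have hW : firstW L (T + 1 - L) wt xt * G = 1 := by
    rw [firstW_eq_of_dynamics hdyn, Matrix.sub_mul, Matrix.mul_assoc, Matrix.mul_assoc,
      ← hGx, ← hGu, hconstr]
  refine ⟨hW, fun δ => ⟨?_, ?_, ?_⟩⟩
  · rw [Matrix.mulVec_mulVec, hW, Matrix.one_mulVec]
  · rw [Matrix.mulVec_mulVec, ← hGx]
  · rw [Matrix.mulVec_mulVec, ← hGu]
end

section
/- Consider the observable uncertain LTI system x_{i+1} = A x_i + B u_i + E w_i, y_i = C x_i + D u_i + F w_i. Suppose the column span of the stacked Hankel matrix [H_{L,init}(ũ); H_{L,init}(w̃); H_{L,init}(ỹ); H_{L,pred}(ũ); H_{L,pred}(w̃); H_{L,pred}(ỹ)] equals the set of L-step (input, disturbance, output) trajectories of the system, with t_init ≥ n_x. Let ḡ and K_d satisfy: ℋ_init ḡ = h_init (where h_init stacks the measured u_init, w_init, y_init over the last t_init steps), H_{L,pred}(w̃) ḡ = 0, ℋ_init K_d = O, H_{L,pred}(w̃) K_d = I, and for every w_pred in the polytope W = {w : F_w w ≤ f_w} the vectors u = H_{L,pred}(ũ)(ḡ + K_d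 w_pred) and y = H_{L,pred}(ỹ)(ḡ + K_d w_pred) satisfy F_u u ≤ f_u and F_y y ≤ f_y. Then for every realized disturbance sequence w_pred ∈ W, applying the input u = H_{L,pred}(ũ)(ḡ + K_d w_pred) to the system initialized consistently with (u_init, w_init, y_init) produces exactly the output y = H_{L,pred}(ỹ)(ḡ + K_d w_pred), so the input and output constraints are satisfied over the n_h-step prediction horizon. -/
open Matrix

/-- The prediction part `H_{L,pred}(s)` of a depth-`L = t_init + n_h` Hankel matrix:
its row blocks are the signal values `t_init, …, t_init + n_h − 1` steps ahead. -/
def HankelPred {ns : ℕ} (s : ℕ → Fin ns → ℝ) (tinit nh nc : ℕ) :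
    Matrix (Fin nh × Fin ns) (Fin nc) ℝ :=
  Matrix.of fun p j => s ((j : ℕ) + tinit + (p.1 : ℕ)) p.2

/-- Observability matrix `[C; CA; …; CA^{n_x−1}]` of the pair `(A,C)`. -/
def obsMat {nx ny : ℕ} (A : Matrix (Fin nx) (Fin nx) ℝ)
    (C : Matrix (Fin ny) (Fin nx) ℝ) : Matrix (Fin nx × Fin ny) (Fin nx) ℝ :=
  Matrix.of fun p j => (C * A ^ (p.1 : ℕ)) p.2 j

/-- The set `B_L(A,B,C,D,E,F)` of `L`-step (input, disturbance, output) trajectories. -/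
def BehaviorUWY {nx nu nw ny : ℕ} (A : Matrix (Fin nx) (Fin nx) ℝ)
    (B : Matrix (Fin nx) (Fin nu) ℝ) (C : Matrix (Fin ny) (Fin nx) ℝ)
    (D : Matrix (Fin ny) (Fin nu) ℝ) (E : Matrix (Fin nx) (Fin nw) ℝ)
    (F : Matrix (Fin ny) (Fin nw) ℝ) (L : ℕ) :
    Set ((Fin L × Fin nu → ℝ) × (Fin L × Fin nw → ℝ) × (Fin L × Fin ny → ℝ)) :=
  { v | ∃ x : ℕ → Fin nx → ℝ,
      (∀ i : Fin L, x (i.val + 1)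
          = A.mulVec (x i.val) + B.mulVec (fun k => v.1 (i, k))
            + E.mulVec (fun k => v.2.1 (i, k))) ∧
      (∀ i : Fin L, (fun k => v.2.2 (i, k))
          = C.mulVec (x i.val) + D.mulVec (fun k => v.1 (i, k))
            + F.mulVec (fun k => v.2.1 (i, k))) }

theorem Matrix.mulVec_injective_of_rank_eq_card {m n K : Type*} [Fintype m] [Fintype n]
    [Field K] {M : Matrix m n K} (h : M.rank = Fintype.card n) :
    Function.Injective M.mulVec := by
  have hker : Module.finrank K (LinearMap.ker M.mulVecLin) = 0 := by
    have hrn := M.mulVecLin.finrank_range_add_finrank_ker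
    rw [Module.finrank_fintype_fun_eq_card] at hrn
    rw [Matrix.rank] at h
    omega
  exact LinearMap.ker_eq_bot.mp (Submodule.finrank_eq_zero.mp hker)

/-- An observable autonomous trajectory whose output vanishes for at least `nx` steps
starts at the origin. -/
theorem eq_zero_of_observable_of_output_eq_zero {nx ny T L : ℕ}
    {A : Matrix (Fin nx) (Fin nx) ℝ} {C : Matrix (Fin ny) (Fin nx) ℝ}
    (hobs : (obsMat A C).rank = nx) (hT : nx ≤ T) (hTL : T ≤ L) {e : ℕ → Fin nx → ℝ}
    (he : ∀ i < L, e (i + 1) = A *ᵥ e i) (hout : ∀ i < T, C *ᵥ e i = 0) :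
    ∀ i ≤ L, e i = 0 := by
  have hpow : ∀ i ≤ L, e i = (A ^ i) *ᵥ e 0 := by
    intro i
    induction i with
    | zero => simp
    | succ i ih =>
      intro hi
      rw [he i hi, ih (by omega), mulVec_mulVec, pow_succ']
  have h0 : e 0 = 0 := by
    apply mulVec_injective_of_rank_eq_card (M := obsMat A C) (by simpa using hobs)
    ext ⟨i, k⟩
    have h := hout i (by omega)
    rw [hpow i (by omega), mulVec_mulVec] at h
    simpa [obsMat, mulVec] using congrFun h k
  intro i hi
  rw [hpow i hi, h0, mulVec_zero]

/-- Two trajectories of an observable system with the same inputs and disturbances whose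
outputs agree for at least `nx` steps have the same outputs. -/
theorem output_eq_of_observable {nx nu nw ny T L : ℕ}
    {A : Matrix (Fin nx) (Fin nx) ℝ} {B : Matrix (Fin nx) (Fin nu) ℝ}
    {C : Matrix (Fin ny) (Fin nx) ℝ} {D : Matrix (Fin ny) (Fin nu) ℝ}
    {E : Matrix (Fin nx) (Fin nw) ℝ} {F : Matrix (Fin ny) (Fin nw) ℝ}
    (hobs : (obsMat A C).rank = nx) (hT : nx ≤ T) (hTL : T ≤ L)
    {x x' : ℕ → Fin nx → ℝ} {u u' : ℕ → Fin nu → ℝ} {w w' : ℕ → Fin nw → ℝ}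
    {y y' : ℕ → Fin ny → ℝ}
    (hu : ∀ i < L, u i = u' i) (hw : ∀ i < L, w i = w' i) (hy : ∀ i < T, y i = y' i)
    (hx : ∀ i < L, x (i + 1) = A *ᵥ x i + B *ᵥ u i + E *ᵥ w i)
    (hx' : ∀ i < L, x' (i + 1) = A *ᵥ x' i + B *ᵥ u' i + E *ᵥ w' i)
    (hout : ∀ i < L, y i = C *ᵥ x i + D *ᵥ u i + F *ᵥ w i)
    (hout' : ∀ i < L, y' i = C *ᵥ x' i + D *ᵥ u' i + F *ᵥ w' i) :
    ∀ i < L, y i = y' i := by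
  have hdiff : ∀ i ≤ L, x i - x' i = 0 := by
    refine eq_zero_of_observable_of_output_eq_zero (e := fun i => x i - x' i)
      hobs hT hTL (fun i hi => ?_) (fun i hi => ?_)
    · simp only [hx i hi, hx' i hi, hu i hi, hw i hi, mulVec_sub]
      abel
    · have hi' : i < L := by omega
      have h := hy i hi
      rw [hout i hi', hout' i hi', hu i hi', hw i hi', add_left_inj, add_left_inj] at h
      rw [mulVec_sub, h, sub_self]
  intro i hi
  rw [hout i hi, hout' i hi, hu i hi, hw i hi, sub_eq_zero.mp (hdiff i hi.le)]

/-- The signal obtained by combining the first `nc` shifts of `s` with weights `g`. -/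
def shiftCombination {ns nc : ℕ} (s : ℕ → Fin ns → ℝ) (g : Fin nc → ℝ) :
    ℕ → Fin ns → ℝ :=
  fun i k => ∑ j : Fin nc, s (j + i) k * g j

theorem Hankel_mulVec {ns nc : ℕ} (s : ℕ → Fin ns → ℝ) (L : ℕ) (g : Fin nc → ℝ) :
    Hankel s L nc *ᵥ g = fun p => shiftCombination s g p.1 p.2 := rfl

theorem HankelPred_mulVec {ns nc : ℕ} (s : ℕ → Fin ns → ℝ) (t n : ℕ) (g : Fin nc → ℝ) :
    HankelPred s t n nc *ᵥ g = fun p => shiftCombination s g (t + p.1) p.2 := by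
  ext p
  simp [HankelPred, shiftCombination, mulVec, dotProduct, add_assoc]

/-- Adding a combination in the kernel of the Hankel matrix does not change the
initial part of the combined signal. -/
theorem shiftCombination_eq_of_Hankel {ns nc T : ℕ} {ι : Type*} [Fintype ι]
    {s a : ℕ → Fin ns → ℝ} {g : Fin nc → ℝ} {K : Matrix (Fin nc) ι ℝ}
    (hg : Hankel s T nc *ᵥ g = fun p => a p.1 p.2) (hK : Hankel s T nc * K = 0)
    (d : ι → ℝ) : ∀ i < T, shiftCombination s (g + K *ᵥ d) i = a i := by
  have h : Hankel s T nc *ᵥ (g + K *ᵥ d) = fun p => a p.1 p.2 := by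
    rw [mulVec_add, mulVec_mulVec, hK, zero_mulVec, add_zero, hg]
  intro i hi
  ext k
  exact congrFun h (⟨i, hi⟩, k)

/-- **Lemma 3 (robust feasibility of robust DeePC)**: if `(ḡ, K_d)` satisfy the
constraints (8) — initial-data consistency `ℋ_init ḡ = h_init`, `H_{L,pred}(w̃) ḡ = 0`,
`ℋ_init K_d = O`, `H_{L,pred}(w̃) K_d = I`, and the robust input/output constraints for
all disturbances in the polytope `W` — then for every realized disturbance `w_pred ∈ W`
the control law `g = ḡ + K_d w_pred` applied to the observable system initialized
consistently with `(u_init, w_init, y_init)` produces exactly the predicted outputs, so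
the input and output constraints hold over the `n_h`-step horizon. -/
theorem robust_deepc_feasibility
    (nx nu nw ny t_init n_h nc mu my mw : ℕ)
    (A : Matrix (Fin nx) (Fin nx) ℝ) (B : Matrix (Fin nx) (Fin nu) ℝ)
    (C : Matrix (Fin ny) (Fin nx) ℝ) (D : Matrix (Fin ny) (Fin nu) ℝ)
    (E : Matrix (Fin nx) (Fin nw) ℝ) (F : Matrix (Fin ny) (Fin nw) ℝ)
    (hobs : (obsMat A C).rank = nx)
    (htinit : nx ≤ t_init)
    (ut : ℕ → Fin nu → ℝ) (wt : ℕ → Fin nw → ℝ) (yt : ℕ → Fin ny → ℝ)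
    (hspan :
      { v : (Fin (t_init + n_h) × Fin nu → ℝ) × (Fin (t_init + n_h) × Fin nw → ℝ)
            × (Fin (t_init + n_h) × Fin ny → ℝ) |
          ∃ g : Fin nc → ℝ,
            (Hankel ut (t_init + n_h) nc).mulVec g = v.1 ∧
            (Hankel wt (t_init + n_h) nc).mulVec g = v.2.1 ∧
            (Hankel yt (t_init + n_h) nc).mulVec g = v.2.2 }
        = BehaviorUWY A B C D E F (t_init + n_h))
    (Fu : Matrix (Fin mu) (Fin n_h × Fin nu) ℝ) (fu : Fin mu → ℝ)
    (Fy : Matrix (Fin my) (Fin n_h × Fin ny) ℝ) (fy : Fin my → ℝ)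
    (Fw : Matrix (Fin mw) (Fin n_h × Fin nw) ℝ) (fw : Fin mw → ℝ)
    (uinit : ℕ → Fin nu → ℝ) (winit : ℕ → Fin nw → ℝ) (yinit : ℕ → Fin ny → ℝ)
    (gbar : Fin nc → ℝ) (Kd : Matrix (Fin nc) (Fin n_h × Fin nw) ℝ)
    (hgu : (Hankel ut t_init nc).mulVec gbar = fun p => uinit (p.1 : ℕ) p.2)
    (hgw : (Hankel wt t_init nc).mulVec gbar = fun p => winit (p.1 : ℕ) p.2)
    (hgy : (Hankel yt t_init nc).mulVec gbar = fun p => yinit (p.1 : ℕ) p.2)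
    (hgpredw : (HankelPred wt t_init n_h nc).mulVec gbar = 0)
    (hKu : Hankel ut t_init nc * Kd = 0)
    (hKw : Hankel wt t_init nc * Kd = 0)
    (hKy : Hankel yt t_init nc * Kd = 0)
    (hKpredw : HankelPred wt t_init n_h nc * Kd = 1)
    (hrob : ∀ wp : Fin n_h × Fin nw → ℝ, Fw.mulVec wp ≤ fw →
        Fu.mulVec ((HankelPred ut t_init n_h nc).mulVec (gbar + Kd.mulVec wp)) ≤ fu ∧
        Fy.mulVec ((HankelPred yt t_init n_h nc).mulVec (gbar + Kd.mulVec wp)) ≤ fy) :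
    ∀ wp : Fin n_h × Fin nw → ℝ, Fw.mulVec wp ≤ fw →
      ∀ (x : ℕ → Fin nx → ℝ) (u : ℕ → Fin nu → ℝ) (w : ℕ → Fin nw → ℝ)
        (y : ℕ → Fin ny → ℝ),
        (∀ i < t_init, u i = uinit i) →
        (∀ i < t_init, w i = winit i) →
        (∀ i < t_init, y i = yinit i) →
        (∀ i : Fin n_h, u (t_init + (i : ℕ))
            = fun k => (HankelPred ut t_init n_h nc).mulVec (gbar + Kd.mulVec wp) (i, k)) →
        (∀ i : Fin n_h, w (t_init + (i : ℕ)) = fun k => wp (i, k)) →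
        (∀ i < t_init + n_h, x (i + 1)
            = A.mulVec (x i) + B.mulVec (u i) + E.mulVec (w i)) →
        (∀ i < t_init + n_h, y i
            = C.mulVec (x i) + D.mulVec (u i) + F.mulVec (w i)) →
        (∀ i : Fin n_h, y (t_init + (i : ℕ))
            = fun k => (HankelPred yt t_init n_h nc).mulVec (gbar + Kd.mulVec wp) (i, k)) ∧
        Fu.mulVec (fun p => u (t_init + (p.1 : ℕ)) p.2) ≤ fu ∧
        Fy.mulVec (fun p => y (t_init + (p.1 : ℕ)) p.2) ≤ fy := by
  intro wp hwp x u w y hu hw hy hupred hwpred hx hout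
  set g := gbar + Kd *ᵥ wp with hgdef
  have hmem : (Hankel ut (t_init + n_h) nc *ᵥ g, Hankel wt (t_init + n_h) nc *ᵥ g,
      Hankel yt (t_init + n_h) nc *ᵥ g) ∈ BehaviorUWY A B C D E F (t_init + n_h) := by
    rw [← hspan]
    exact ⟨g, rfl, rfl, rfl⟩
  obtain ⟨z, hz, hzout⟩ := hmem
  have hgw' : HankelPred wt t_init n_h nc *ᵥ g = wp := by
    rw [hgdef, mulVec_add, mulVec_mulVec, hKpredw, one_mulVec, hgpredw, zero_add]
  rw [HankelPred_mulVec] at hgw'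
  simp only [HankelPred_mulVec] at hupred hrob ⊢
  have hU : ∀ i < t_init + n_h, u i = shiftCombination ut g i := by
    intro i hi
    rcases lt_or_ge i t_init with h | h
    · rw [hu i h, shiftCombination_eq_of_Hankel hgu hKu wp i h]
    · obtain ⟨j, rfl⟩ := Nat.exists_eq_add_of_le h
      exact hupred ⟨j, by omega⟩
  have hW : ∀ i < t_init + n_h, w i = shiftCombination wt g i := by
    intro i hi
    rcases lt_or_ge i t_init with h | h
    · rw [hw i h, shiftCombination_eq_of_Hankel hgw hKw wp i h]
    · obtain ⟨j, rfl⟩ := Nat.exists_eq_add_of_le h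
      rw [hwpred ⟨j, by omega⟩, ← hgw']
  have hY : ∀ i < t_init + n_h, y i = shiftCombination yt g i :=
    output_eq_of_observable hobs htinit (Nat.le_add_right _ _) hU hW
      (fun i hi => by rw [hy i hi, shiftCombination_eq_of_Hankel hgy hKy wp i hi])
      hx (fun i hi => hz ⟨i, hi⟩) hout (fun i hi => hzout ⟨i, hi⟩)
  have hUpred : (fun p : Fin n_h × Fin nu => u (t_init + p.1) p.2) =
      fun p => shiftCombination ut g (t_init + p.1) p.2 :=
    funext fun p => congrFun (hU _ (by omega)) p.2
  have hYpred : (fun p : Fin n_h × Fin ny => y (t_init + p.1) p.2) =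
      fun p => shiftCombination yt g (t_init + p.1) p.2 :=
    funext fun p => congrFun (hY _ (by omega)) p.2
  rw [hUpred, hYpred]
  exact ⟨fun i => hY _ (by omega), hrob wp hwp⟩
end

section
/- Let H ∈ ℝ^{n_r × n_c} have full row rank n_r ≤ n_c, and let Hᵀ = [Q_a, Q_b][R; O] be its QR decomposition, with Q_a ∈ ℝ^{n_c × n_r}, Q_b ∈ ℝ^{n_c × (n_c − n_r)}, [Q_a, Q_b] orthogonal, and R upper triangular and invertible. Partition the rows of H into an initial block of n_init rows followed by n_h blocks of n_u + n_y rows each (so n_r = n_init + n_h(n_u+n_y)). Then a matrix K_d ∈ ℝ^{n_c × n_h n_w}, partitioned into column blocks K_{d,:,1},…,K_{d,:,n_h} of n_w columns each, satisfies the causality conditions "the first n_init + (j−1)(n_u+n_y) rows of H annihilate K_{d,:,j} for every j = 1,…,n_h" if and only if K_d = [Q_{a,:,n_init+1:n_r}, Q_b] K_p for some matrix K_p that is block-lower-triangular with respect to the partition into n_h block rows (of sizes (n_u+n_y) for block rows 1,…,n_h−1 and n_y + (n_c − n_r) for block row n_h) and n_h block columns of n_w columns each. -/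
open Matrix

/-- If an upper triangular invertible `R` has `Rᵀ y` vanishing in its first `m` entries, then so
does `y`. -/
theorem eq_zero_of_upperTriangular_transpose_mulVec {n m : ℕ} {R : Matrix (Fin n) (Fin n) ℝ}
    (hRtri : ∀ i j : Fin n, (j : ℕ) < (i : ℕ) → R i j = 0) (hRinv : IsUnit R) {y : Fin n → ℝ}
    (h : ∀ i : Fin n, (i : ℕ) < m → (Rᵀ *ᵥ y) i = 0) (i : Fin n) (hi : (i : ℕ) < m) : y i = 0 := by
  have hdiag : R i i ≠ 0 := by
    have hdet : R.det ≠ 0 := ((Matrix.isUnit_iff_isUnit_det R).1 hRinv).ne_zero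
    rw [Matrix.det_of_isUpperTriangular (fun a b hab => hRtri a b hab)] at hdet
    exact Finset.prod_ne_zero_iff.1 hdet i (Finset.mem_univ i)
  have hsum := h i hi
  rw [Matrix.mulVec, dotProduct, Finset.sum_eq_single i] at hsum
  · exact (mul_eq_zero.1 hsum).resolve_left hdiag
  · intro k _ hki
    rcases lt_or_gt_of_ne hki with hlt | hgt
    · have := eq_zero_of_upperTriangular_transpose_mulVec hRtri hRinv h k
        (lt_trans (Fin.lt_def.1 hlt) hi)
      rw [this, mul_zero]
    · rw [Matrix.transpose_apply, hRtri k i hgt, zero_mul]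
  · simp
termination_by (i : ℕ)
decreasing_by exact hlt

/-- If `R` is upper triangular and the first `m` entries of `y` vanish, then so do those of
`Rᵀ y`. -/
theorem upperTriangular_transpose_mulVec_eq_zero {n m : ℕ} {R : Matrix (Fin n) (Fin n) ℝ}
    (hRtri : ∀ i j : Fin n, (j : ℕ) < (i : ℕ) → R i j = 0) {y : Fin n → ℝ}
    (h : ∀ i : Fin n, (i : ℕ) < m → y i = 0) (i : Fin n) (hi : (i : ℕ) < m) :
    (Rᵀ *ᵥ y) i = 0 := by
  rw [Matrix.mulVec, dotProduct]
  refine Finset.sum_eq_zero fun k _ => ?_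
  by_cases hk : (i : ℕ) < k
  · rw [Matrix.transpose_apply, hRtri k i hk, zero_mul]
  · rw [h k (by omega), mul_zero]

/-- A sum over `Fin n` whose first `a` terms vanish. -/
theorem sum_fin_eq_sum_shift {n a : ℕ} (f : Fin n → ℝ)
    (hf : ∀ i : Fin n, (i : ℕ) < a → f i = 0) :
    ∑ i, f i = ∑ r : Fin (n - a), f ⟨a + (r : ℕ), by have := r.isLt; omega⟩ := by
  symm
  refine Finset.sum_of_injOn (fun r : Fin (n - a) => ⟨a + (r : ℕ), by have := r.isLt; omega⟩)
    ?_ (by simp) ?_ (by simp)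
  · intro r _ s _ hrs
    simpa [Fin.ext_iff] using hrs
  · intro i _ hi
    refine hf i (not_le.1 fun hai => hi ?_)
    exact ⟨⟨i - a, by have := i.isLt; omega⟩, by simp, Fin.ext (by simp; omega)⟩

/-- **Causality via QR decomposition** (key step of Theorem 2): let `H` have full row
rank with QR decomposition `Hᵀ = [Q_a, Q_b][R; O]`, and partition its rows into an
initial block of `n_init` rows followed by `n_h` blocks of `n_u + n_y` rows.  A matrix
`K_d`, partitioned into `n_h` column blocks of `n_w` columns, satisfies the causality
conditions (the first `n_init + (j−1)(n_u+n_y)` rows of `H` annihilate its `j`-th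
column block) iff `K_d = [Q_{a,:,n_init+1:n_r}, Q_b] K_p` for some block-lower-triangular
`K_p`. -/
theorem qr_causality_parametrization
    (n_r n_c n_init n_h n_u n_y n_w : ℕ)
    (hr : n_r = n_init + n_h * (n_u + n_y))
    (hrc : n_r ≤ n_c)
    (H : Matrix (Fin n_r) (Fin n_c) ℝ)
    (hrank : H.rank = n_r)
    (Qa : Matrix (Fin n_c) (Fin n_r) ℝ)
    (Qb : Matrix (Fin n_c) (Fin (n_c - n_r)) ℝ)
    (R : Matrix (Fin n_r) (Fin n_r) ℝ)
    (horth : (Matrix.of fun i (c : Fin n_r ⊕ Fin (n_c - n_r)) => Sum.elim (Qa i) (Qb i) c)ᵀ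
        * (Matrix.of fun i (c : Fin n_r ⊕ Fin (n_c - n_r)) => Sum.elim (Qa i) (Qb i) c) = 1)
    (hRtri : ∀ i j : Fin n_r, (j : ℕ) < (i : ℕ) → R i j = 0)
    (hRinv : IsUnit R)
    (hQR : Hᵀ = Qa * R)
    (K_d : Matrix (Fin n_c) (Fin n_h × Fin n_w) ℝ) :
    (∀ (j : Fin n_h) (l : Fin n_w) (i : Fin n_r),
        (i : ℕ) < n_init + (j : ℕ) * (n_u + n_y) →
        H.mulVec (fun c => K_d c (j, l)) i = 0) ↔
    ∃ K_p : Matrix (Fin (n_r - n_init) ⊕ Fin (n_c - n_r)) (Fin n_h × Fin n_w) ℝ,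
      (∀ (r : Fin (n_r - n_init)) (j : Fin n_h) (l : Fin n_w),
          (r : ℕ) < (j : ℕ) * (n_u + n_y) → K_p (Sum.inl r) (j, l) = 0) ∧
      K_d = (Matrix.of fun i (c : Fin (n_r - n_init) ⊕ Fin (n_c - n_r)) =>
          Sum.elim (fun r : Fin (n_r - n_init) => Qa i ⟨n_init + (r : ℕ), by have := r.isLt; omega⟩) (Qb i) c)
        * K_p := by
  set Q : Matrix (Fin n_c) (Fin n_r ⊕ Fin (n_c - n_r)) ℝ :=
    Matrix.of fun i c => Sum.elim (Qa i) (Qb i) c with hQ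
  have hQQ : Q * Qᵀ = 1 :=
    (Matrix.mul_eq_one_comm_of_card_eq _ _ _ (by simp; omega)).1 horth
  have haa : ∀ k k', ∑ i, Qa i k * Qa i k' = if k = k' then 1 else 0 := fun k k' => by
    simpa [Matrix.mul_apply, hQ, Matrix.one_apply] using congrFun₂ horth (Sum.inl k) (Sum.inl k')
  have hab : ∀ k k', ∑ i, Qa i k * Qb i k' = 0 := fun k k' => by
    simpa [Matrix.mul_apply, hQ, Matrix.one_apply] using congrFun₂ horth (Sum.inl k) (Sum.inr k')
  have hH : ∀ v, H *ᵥ v = Rᵀ *ᵥ (Qaᵀ *ᵥ v) := fun v => by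
    rw [Matrix.mulVec_mulVec, ← Matrix.transpose_mul, ← hQR, Matrix.transpose_transpose]
  constructor
  · intro h
    have hzero : ∀ (j : Fin n_h) (l : Fin n_w) (k : Fin n_r),
        (k : ℕ) < n_init + (j : ℕ) * (n_u + n_y) → (Qᵀ * K_d) (Sum.inl k) (j, l) = 0 := by
      intro j l k hk
      exact eq_zero_of_upperTriangular_transpose_mulVec hRtri hRinv
        (fun i hi => by rw [← hH]; exact h j l i hi) k hk
    refine ⟨Matrix.of fun c p => Sum.elim
      (fun r : Fin (n_r - n_init) =>
        (Qᵀ * K_d) (Sum.inl ⟨n_init + (r : ℕ), by have := r.isLt; omega⟩) p)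
      (fun b => (Qᵀ * K_d) (Sum.inr b) p) c, ?_, ?_⟩
    · intro r j l hrj
      exact hzero j l _ (by simpa using hrj)
    · ext i ⟨j, l⟩
      have hK : K_d = Q * (Qᵀ * K_d) := by rw [← Matrix.mul_assoc, hQQ, Matrix.one_mul]
      conv_lhs => rw [hK, Matrix.mul_apply, Fintype.sum_sum_type]
      rw [Matrix.mul_apply, Fintype.sum_sum_type]
      congr 1
      refine sum_fin_eq_sum_shift
        (fun k => Q i (Sum.inl k) * (Qᵀ * K_d) (Sum.inl k) (j, l)) fun k hk => ?_
      simp only [hzero j l k (by omega), mul_zero]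
  · rintro ⟨K_p, hKp, rfl⟩ j l i hi
    rw [hH]
    refine upperTriangular_transpose_mulVec_eq_zero hRtri (fun k hk => ?_) i hi
    simp only [Matrix.mulVec, dotProduct, Matrix.mul_apply, Matrix.transpose_apply,
      Finset.mul_sum]
    rw [Finset.sum_comm, Fintype.sum_sum_type]
    simp only [Matrix.of_apply, Sum.elim_inl, Sum.elim_inr, ← mul_assoc, ← Finset.sum_mul,
      haa, hab, zero_mul, Finset.sum_const_zero, add_zero]
    refine Finset.sum_eq_zero fun r _ => ?_
    split_ifs with hkr
    · have hv := congrArg Fin.val hkr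
      simp only at hv
      rw [hKp r j l (by omega), mul_zero]
    · rw [zero_mul]
end
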